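/- Let A be the 11-vertex graph with vertices c, p1, p2, p3, x, y, z, q1, q2, q3, d and edges c p1, c p3, p1 p2, p2 p3, p1 x, p3 x, x y, y z, z q1, z q3, q1 q2, q2 q3, q1 d, q3 d (and no other edges). Then every claw deletion set of A has at least 2 vertices, and {x, z} is the unique claw deletion set of A of size 2. -/

import Mathlib

/-- `G` has an induced subgraph isomorphic to the `d`-claw `K_{1,d}`:
a center `v` together with `d` pairwise nonadjacent leaves adjacent to `v`. -/
def HasNClaw {V : Type*} (G : SimpleGraph V) (d : ℕ) : Prop :=
  ∃ (v : V) (s : Finset V), s.card = d ∧ v ∉ s ∧ (∀ u ∈ s, G.Adj v u) ∧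
    ∀ u ∈ s, ∀ w ∈ s, u ≠ w → ¬ G.Adj u w

/-- `S` is a `d`-claw deletion set of `G`: `G − S` has no induced `K_{1,d}`. -/
def IsClawDeletionSet {V : Type*} (G : SimpleGraph V) (d : ℕ) (S : Set V) : Prop :=
  ¬ HasNClaw (G.induce Sᶜ) d

/-- `S` is a vertex cover of `G`. -/
def IsVertexCoverSet {V : Type*} (G : SimpleGraph V) (S : Set V) : Prop :=
  ∀ ⦃u v⦄, G.Adj u v → u ∈ S ∨ v ∈ S

/-- The 11-vertex graph `A` with labels `0 = c`, `1 = p1`, `2 = p2`, `3 = p3`, `4 = x`,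
`5 = y`, `6 = z`, `7 = q1`, `8 = q2`, `9 = q3`, `10 = d`, and edges
`c p1, c p3, p1 p2, p2 p3, p1 x, p3 x, x y, y z, z q1, z q3, q1 q2, q2 q3, q1 d, q3 d`. -/
def gadgetA : SimpleGraph (Fin 11) :=
  SimpleGraph.fromRel (fun i j =>
    (i, j) ∈ ([(0, 1), (0, 3), (1, 2), (2, 3), (1, 4), (3, 4), (4, 5), (5, 6), (6, 7),
      (6, 9), (7, 8), (8, 9), (7, 10), (9, 10)] : List (Fin 11 × Fin 11)))

/-- A claw deletion set meets every claw of the graph. -/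
theorem IsClawDeletionSet.mem_of_claw {V : Type*} {G : SimpleGraph V} {S : Set V}
    (hS : IsClawDeletionSet G 3 S) {v a b c : V}
    (hva : G.Adj v a) (hvb : G.Adj v b) (hvc : G.Adj v c)
    (hab : a ≠ b) (hac : a ≠ c) (hbc : b ≠ c)
    (nab : ¬ G.Adj a b) (nac : ¬ G.Adj a c) (nbc : ¬ G.Adj b c) :
    v ∈ S ∨ a ∈ S ∨ b ∈ S ∨ c ∈ S := by
  classical
  by_contra! h
  obtain ⟨hv, ha, hb, hc⟩ := h
  refine hS ⟨⟨v, hv⟩, {⟨a, ha⟩, ⟨b, hb⟩, ⟨c, hc⟩}, ?_, ?_, ?_, ?_⟩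
  · exact Finset.card_eq_three.mpr
      ⟨_, _, _, by simpa using hab, by simpa using hac, by simpa using hbc, rfl⟩
  · simp [hva.ne, hvb.ne, hvc.ne]
  · simp [hva, hvb, hvc]
  · simp [nab, nac, nbc, G.adj_comm b a, G.adj_comm c a, G.adj_comm c b]

/-- If every vertex outside `S` has fewer than `d` neighbours outside `S`, then `S` is a
`d`-claw deletion set. -/
theorem isClawDeletionSet_of_card_lt {V : Type*} {G : SimpleGraph V} {d : ℕ} {S : Set V}
    (N : V → Finset V) (hN : ∀ v ∉ S, ∀ u ∉ S, G.Adj v u → u ∈ N v)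
    (hd : ∀ v ∉ S, (N v).card < d) : IsClawDeletionSet G d S := by
  rintro ⟨v, s, hs, -, hadj, -⟩
  have hsub : s.map (Function.Embedding.subtype _) ⊆ N v := by
    intro u hu
    obtain ⟨w, hw, rfl⟩ := Finset.mem_map.mp hu
    exact hN v v.2 w w.2 (hadj w hw)
  have := Finset.card_le_card hsub
  rw [Finset.card_map, hs] at this
  exact (hd v v.2).not_ge this

instance : DecidableRel gadgetA.Adj :=
  fun a b => decidable_of_iff _ (SimpleGraph.fromRel_adj _ a b).symm

/-- Every claw deletion set of `gadgetA` contains one vertex of the claw centred at `p1` and one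
of the disjoint claw centred at `q1`. -/
theorem exists_mem_claws_of_isClawDeletionSet_gadgetA {S : Set (Fin 11)}
    (hS : IsClawDeletionSet gadgetA 3 S) :
    ∃ u ∈ S, ∃ w ∈ S, u ∈ ({0, 1, 2, 4} : Finset (Fin 11)) ∧
      w ∈ ({6, 7, 8, 10} : Finset (Fin 11)) := by
  have h₁ : (1 : Fin 11) ∈ S ∨ 0 ∈ S ∨ 2 ∈ S ∨ 4 ∈ S := by
    apply hS.mem_of_claw <;> decide
  have h₂ : (7 : Fin 11) ∈ S ∨ 6 ∈ S ∨ 8 ∈ S ∨ 10 ∈ S := by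
    apply hS.mem_of_claw <;> decide
  obtain ⟨u, hu, hu'⟩ : ∃ u ∈ S, u ∈ ({0, 1, 2, 4} : Finset (Fin 11)) := by
    rcases h₁ with h | h | h | h <;> exact ⟨_, h, by decide⟩
  obtain ⟨w, hw, hw'⟩ : ∃ w ∈ S, w ∈ ({6, 7, 8, 10} : Finset (Fin 11)) := by
    rcases h₂ with h | h | h | h <;> exact ⟨_, h, by decide⟩
  exact ⟨u, hu, w, hw, hu', hw'⟩

theorem ne_of_mem_claws_gadgetA : ∀ u ∈ ({0, 1, 2, 4} : Finset (Fin 11)),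
    ∀ w ∈ ({6, 7, 8, 10} : Finset (Fin 11)), u ≠ w := by
  decide

theorem stmt10 :
    (∀ S : Set (Fin 11), IsClawDeletionSet gadgetA 3 S → 2 ≤ S.ncard) ∧
    (IsClawDeletionSet gadgetA 3 {4, 6} ∧ ({4, 6} : Set (Fin 11)).ncard = 2) ∧
    (∀ S : Set (Fin 11), IsClawDeletionSet gadgetA 3 S → S.ncard = 2 → S = {4, 6}) := by
  refine ⟨fun S hS => ?_, ⟨?_, Set.ncard_pair (by decide)⟩, fun S hS hcard => ?_⟩
  · obtain ⟨u, hu, w, hw, hu', hw'⟩ := exists_mem_claws_of_isClawDeletionSet_gadgetA hS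
    rw [← Set.ncard_pair (ne_of_mem_claws_gadgetA u hu' w hw')]
    exact Set.ncard_le_ncard (Set.pair_subset hu hw)
  · refine isClawDeletionSet_of_card_lt
      (fun v => Finset.univ.filter fun u => u ≠ 4 ∧ u ≠ 6 ∧ gadgetA.Adj v u) ?_ ?_
    · intro v _ u hu huv
      simp only [Set.mem_insert_iff, Set.mem_singleton_iff, not_or] at hu
      simp [hu.1, hu.2, huv]
    · simp only [Set.mem_insert_iff, Set.mem_singleton_iff]
      decide
  · obtain ⟨u, hu, w, hw, hu', hw'⟩ := exists_mem_claws_of_isClawDeletionSet_gadgetA hS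
    have hpair : ({u, w} : Set (Fin 11)) = S :=
      Set.eq_of_subset_of_ncard_le (Set.pair_subset hu hw)
        (by rw [Set.ncard_pair (ne_of_mem_claws_gadgetA u hu' w hw'), hcard])
    have h₃ : (3 : Fin 11) ∈ S ∨ 0 ∈ S ∨ 2 ∈ S ∨ 4 ∈ S := by
      apply hS.mem_of_claw <;> decide
    have h₄ : (4 : Fin 11) ∈ S ∨ 1 ∈ S ∨ 3 ∈ S ∨ 5 ∈ S := by
      apply hS.mem_of_claw <;> decide
    have h₆ : (6 : Fin 11) ∈ S ∨ 5 ∈ S ∨ 7 ∈ S ∨ 9 ∈ S := by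
      apply hS.mem_of_claw <;> decide
    have h₉ : (9 : Fin 11) ∈ S ∨ 6 ∈ S ∨ 8 ∈ S ∨ 10 ∈ S := by
      apply hS.mem_of_claw <;> decide
    subst hpair
    simp only [Set.mem_insert_iff, Set.mem_singleton_iff] at h₃ h₄ h₆ h₉
    obtain ⟨rfl, rfl⟩ : u = 4 ∧ w = 6 := by
      simp only [Finset.mem_insert, Finset.mem_singleton] at hu' hw'
      omega
    rfl
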